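/- arXiv:2108.05262 — 2 statements merged into one kernel-verified Lean document; each statement's English description precedes it below -/
import Mathlib

section
/- Let k be a commutative ring of characteristic m > 0, let p be a prime, and let G = ℤ_p^d be the d-fold product of the additive group of p-adic integers, with its product topology. Let V be a smooth representation of G over k. Then every 1-cocycle χ : G → V is continuous when V carries the discrete topology; in fact, χ vanishes on some open subgroup of G. -/
/-- An open subgroup of `ℤ_[p]^d` containing the standard basis vectors is everything. -/
theorem AddSubgroup.mem_of_isOpen_of_single_mem {p : ℕ} [Fact p.Prime] {d : ℕ}
    (S : AddSubgroup (Fin d → ℤ_[p])) (hS : IsOpen (S : Set (Fin d → ℤ_[p])))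
    (h1 : ∀ i, Pi.single i 1 ∈ S) (x : Fin d → ℤ_[p]) : x ∈ S := by
  have hcl : IsClosed (S : Set (Fin d → ℤ_[p])) := S.isClosed_of_isOpen hS
  rw [← Finset.univ_sum_single x]
  refine S.sum_mem fun i _ => ?_
  refine (PadicInt.denseRange_natCast (p := p)).induction_on
    (p := fun a => (Pi.single i a : Fin d → ℤ_[p]) ∈ S) (x i) (hcl.preimage (continuous_single (A := fun _ : Fin d => ℤ_[p]) i)) fun n => ?_
  have := S.nsmul_mem (h1 i) n
  rwa [← Pi.single_smul, nsmul_one] at this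

/-- Multiplication by a positive integer sends open subgroups of `ℤ_[p]^d` to open subgroups. -/
theorem AddSubgroup.isOpen_map_nsmul_padicInt_pi {p : ℕ} [Fact p.Prime] {d : ℕ}
    (U : AddSubgroup (Fin d → ℤ_[p])) (hU : IsOpen (U : Set (Fin d → ℤ_[p])))
    {m : ℕ} (hm : m ≠ 0) :
    IsOpen (U.map (nsmulAddMonoidHom m) : Set (Fin d → ℤ_[p])) := by
  obtain ⟨ε, hε, hball⟩ := Metric.isOpen_iff.1 hU 0 U.zero_mem
  have hm0 : (m : ℤ_[p]) ≠ 0 := Nat.cast_ne_zero.2 hm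
  have hmpos : 0 < ‖(m : ℤ_[p])‖ := norm_pos_iff.2 hm0
  refine AddSubgroup.isOpen_of_mem_nhds _ (g := 0) <| Metric.mem_nhds_iff.2
    ⟨min ε 1 * ‖(m : ℤ_[p])‖, by positivity, fun x hx => ?_⟩
  rw [mem_ball_zero_iff] at hx
  have hdvd : ∀ i, ∃ y : ℤ_[p], x i = m * y := fun i => by
    have hle : ‖x i‖ ≤ ‖(m : ℤ_[p])‖ := (norm_le_pi_norm x i).trans <| hx.le.trans <|
      mul_le_of_le_one_left hmpos.le (min_le_right _ _)
    have hm' : (m : ℚ_[p]) ≠ 0 := Nat.cast_ne_zero.2 hm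
    refine ⟨⟨x i / m, ?_⟩, PadicInt.ext ?_⟩
    · rw [norm_div]
      exact div_le_one_of_le₀ (by rwa [PadicInt.norm_def, PadicInt.norm_def, PadicInt.coe_natCast] at hle) (norm_nonneg _)
    · change (x i : ℚ_[p]) = ((m : ℤ_[p]) : ℚ_[p]) * (x i / m)
      rw [PadicInt.coe_natCast]
      field_simp
  choose y hy using hdvd
  refine ⟨y, hball ?_, ?_⟩
  · rw [mem_ball_zero_iff, pi_norm_lt_iff hε]
    intro i
    have h := (norm_le_pi_norm x i).trans_lt hx
    rw [hy, norm_mul, mul_comm] at h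
    exact (lt_of_mul_lt_mul_right h hmpos.le).trans_le (min_le_left _ _)
  · ext1 i
    simp [hy]


/-- Let `k` be a commutative ring of characteristic `m > 0`, `p` a prime, and
`G = ℤ_[p]^d` with the product topology.  Let `V` be a smooth representation of `G`
over `k`, given by linear automorphisms `ρ x : V ≃ₗ[k] V` with
`ρ (x + y) = ρ x ∘ ρ y` and `ρ 0 = id`.  Then every 1-cocycle `χ : G → V` is
continuous for the discrete topology on `V` (i.e. locally constant); in fact `χ`
vanishes on some open subgroup of `G`. -/
theorem cocycle_isLocallyConstant_padic_pow
    {k : Type*} [CommRing k] (m : ℕ) (hm : 0 < m) [CharP k m]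
    {p : ℕ} [Fact p.Prime] (d : ℕ)
    {V : Type*} [AddCommGroup V] [Module k V]
    (ρ : (Fin d → ℤ_[p]) → (V ≃ₗ[k] V))
    (hρ_add : ∀ x y : Fin d → ℤ_[p], ∀ v : V, ρ (x + y) v = ρ x (ρ y v))
    (hρ_zero : ∀ v : V, ρ 0 v = v)
    (hsm : ∀ v : V, ∃ U : OpenAddSubgroup (Fin d → ℤ_[p]), ∀ u ∈ U, ρ u v = v)
    (χ : (Fin d → ℤ_[p]) → V)
    (hχ : ∀ x y : Fin d → ℤ_[p], χ (x + y) = χ x + ρ x (χ y)) :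
    IsLocallyConstant χ ∧
      ∃ U : OpenAddSubgroup (Fin d → ℤ_[p]), ∀ u ∈ U, χ u = 0 := by
  have hopen : ∃ U : OpenAddSubgroup (Fin d → ℤ_[p]), ∀ u ∈ U, χ u = 0 := by
    choose U hU using hsm
    let W : OpenAddSubgroup (Fin d → ℤ_[p]) :=
      ⟨⨅ i, (U (χ (Pi.single i 1))).toAddSubgroup, by
        change IsOpen ((⨅ i, (U (χ (Pi.single i 1))).toAddSubgroup : AddSubgroup _) :
          Set (Fin d → ℤ_[p]))
        rw [AddSubgroup.coe_iInf]
        exact isOpen_iInter_of_finite fun i => (U (χ (Pi.single i 1))).isOpen⟩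
    have hW : ∀ u ∈ W, ∀ i, ρ u (χ (Pi.single i 1)) = χ (Pi.single i 1) := fun u hu i =>
      hU _ _ (AddSubgroup.mem_iInf.1 hu i)
    have hfix : ∀ u ∈ W, ∀ x, ρ x (χ u) = χ u := by
      intro u hu
      let S : AddSubgroup (Fin d → ℤ_[p]) :=
        { carrier := {x | ρ x (χ u) = χ u}
          zero_mem' := hρ_zero _
          add_mem' := fun {a b} (ha : ρ a _ = _) (hb : ρ b _ = _) => by
            rw [Set.mem_ofPred_eq, hρ_add, hb, ha]
          neg_mem' := fun {a} (ha : ρ a _ = _) => by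
            rw [Set.mem_ofPred_eq]
            conv_lhs => rw [← ha]
            rw [← hρ_add, neg_add_cancel, hρ_zero] }
      refine S.mem_of_isOpen_of_single_mem
        (AddSubgroup.isOpen_mono (H₁ := (U (χ u)).toAddSubgroup) (hU _) (U (χ u)).isOpen)
        fun i => ?_
      have h := hχ u (Pi.single i 1)
      rw [hW u hu i, add_comm u, hχ, add_comm (χ u)] at h
      exact add_left_cancel h
    refine ⟨⟨W.toAddSubgroup.map (nsmulAddMonoidHom m),
      AddSubgroup.isOpen_map_nsmul_padicInt_pi _ W.isOpen hm.ne'⟩, ?_⟩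
    rintro _ ⟨u, hu, rfl⟩
    have hχ0 : χ 0 = 0 := by simpa [hρ_zero] using hχ 0 0
    have hmul : ∀ n : ℕ, χ (n • u) = n • χ u := fun n => by
      induction n with
      | zero => simpa using hχ0
      | succ n ih => rw [succ_nsmul, hχ, hfix u hu, ih, succ_nsmul]
    rw [nsmulAddMonoidHom_apply, hmul, ← Nat.cast_smul_eq_nsmul k, CharP.cast_eq_zero, zero_smul]
  refine ⟨?_, hopen⟩
  obtain ⟨U, hU⟩ := hopen
  refine (IsLocallyConstant.iff_eventually_eq χ).2 fun x => ?_
  have hx : Filter.Tendsto (fun y => y - x) (nhds x) (nhds 0) := by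
    simpa using (continuous_sub_right x).tendsto x
  filter_upwards [hx U.mem_nhds_zero] with y hy
  have h := hχ x (y - x)
  rwa [hU _ hy, map_zero, add_zero, add_sub_cancel] at h
end

section
/- Let k be a commutative ring of characteristic m > 0 and let p be a prime. Let V be a smooth representation of the additive topological group ℤ_p of p-adic integers over k. Then every 1-cocycle χ : ℤ_p → V is continuous when V carries the discrete topology. -/
/-- A vector with open stabilizer that is fixed by `1` is fixed by all of `ℤ_[p]`. -/
theorem PadicInt.fixed_of_fixed_one {p : ℕ} [Fact p.Prime] {V : Type*}
    (ρ : ℤ_[p] → V → V)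
    (hρ_add : ∀ x y : ℤ_[p], ∀ v : V, ρ (x + y) v = ρ x (ρ y v))
    (hρ_zero : ∀ v : V, ρ 0 v = v) {w : V} (U : OpenAddSubgroup ℤ_[p])
    (hU : ∀ u ∈ U, ρ u w = w) (h1 : ρ 1 w = w) (x : ℤ_[p]) : ρ x w = w := by
  have hnat : ∀ n : ℕ, ρ (n : ℤ_[p]) w = w := by
    intro n
    induction n with
    | zero => simpa using hρ_zero w
    | succ n ih => rw [Nat.cast_succ, hρ_add, h1, ih]
  have hopen : IsOpen {y : ℤ_[p] | x - y ∈ U} :=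
    U.isOpen.preimage (continuous_const.sub continuous_id)
  obtain ⟨n, hn⟩ := PadicInt.denseRange_natCast.exists_mem_open hopen
    ⟨x, by simp⟩
  rw [← sub_add_cancel x (n : ℤ_[p]), hρ_add, hnat, hU _ hn]

/-- Every sufficiently small `p`-adic integer is `m` times an element of a given
neighbourhood of zero, when `m ≠ 0`. -/
theorem PadicInt.eventually_exists_natCast_mul {p : ℕ} [Fact p.Prime] {m : ℕ} (hm : m ≠ 0)
    (U : OpenAddSubgroup ℤ_[p]) :
    ∀ᶠ y : ℤ_[p] in nhds 0, ∃ u ∈ U, y = m * u := by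
  obtain ⟨ε, hε, hball⟩ := Metric.isOpen_iff.mp U.isOpen 0 U.zero_mem
  have hmQ : (m : ℚ_[p]) ≠ 0 := Nat.cast_ne_zero.mpr hm
  have hpos : 0 < ‖(m : ℚ_[p])‖ := norm_pos_iff.mpr hmQ
  filter_upwards [Metric.ball_mem_nhds (0 : ℤ_[p]) (mul_pos (lt_min hε one_pos) hpos)] with y hy
  rw [mem_ball_zero_iff, ← div_lt_iff₀ hpos, PadicInt.norm_def, ← norm_div] at hy
  obtain ⟨z, hz⟩ : ∃ z : ℤ_[p], (z : ℚ_[p]) = (y : ℚ_[p]) / m :=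
    ⟨⟨_, (hy.trans_le (min_le_right _ _)).le⟩, rfl⟩
  rw [← hz] at hy
  refine ⟨z, hball ?_, ?_⟩
  · rw [mem_ball_zero_iff, PadicInt.norm_def]
    exact hy.trans_le (min_le_left _ _)
  · apply PadicInt.ext
    rw [PadicInt.coe_mul, PadicInt.coe_natCast, hz, mul_div_cancel₀ _ hmQ]

/-- Let `k` be a commutative ring of characteristic `m > 0` and `p` a prime.  Let `V`
be a smooth representation of the additive topological group `ℤ_[p]` over `k`, given by
linear automorphisms `ρ x : V ≃ₗ[k] V` with `ρ (x + y) = ρ x ∘ ρ y` and `ρ 0 = id`.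
Then every 1-cocycle `χ : ℤ_[p] → V` is continuous for the discrete topology on `V`,
i.e. locally constant. -/
theorem cocycle_isLocallyConstant_padicInt
    {k : Type*} [CommRing k] (m : ℕ) (hm : 0 < m) [CharP k m]
    {p : ℕ} [Fact p.Prime]
    {V : Type*} [AddCommGroup V] [Module k V]
    (ρ : ℤ_[p] → (V ≃ₗ[k] V))
    (hρ_add : ∀ x y : ℤ_[p], ∀ v : V, ρ (x + y) v = ρ x (ρ y v))
    (hρ_zero : ∀ v : V, ρ 0 v = v)
    (hsm : ∀ v : V, ∃ U : OpenAddSubgroup ℤ_[p], ∀ u ∈ U, ρ u v = v)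
    (χ : ℤ_[p] → V)
    (hχ : ∀ x y : ℤ_[p], χ (x + y) = χ x + ρ x (χ y)) :
    IsLocallyConstant χ := by
  obtain ⟨U, hU⟩ := hsm (χ 1)
  have hinv : ∀ u ∈ U, ∀ x, ρ x (χ u) = χ u := by
    intro u hu
    obtain ⟨W, hW⟩ := hsm (χ u)
    refine PadicInt.fixed_of_fixed_one (fun x v => ρ x v) hρ_add hρ_zero W hW ?_
    have h := hχ u 1
    rw [add_comm u 1, hχ 1 u, hU u hu, add_comm (χ u)] at h
    exact add_left_cancel h
  have hzero : χ 0 = 0 := by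
    have h := hχ 0 0
    rwa [add_zero, hρ_zero, left_eq_add] at h
  have hmul : ∀ u ∈ U, ∀ n : ℕ, χ (n * u) = n • χ u := by
    intro u hu n
    induction n with
    | zero => simpa using hzero
    | succ n ih => rw [Nat.cast_succ, add_mul, one_mul, hχ, ih, hinv u hu, succ_nsmul]
  rw [IsLocallyConstant.iff_eventually_eq]
  intro x
  have hlim : Filter.Tendsto (fun y => y - x) (nhds x) (nhds 0) := by
    simpa using (continuous_id.sub continuous_const).tendsto (f := fun y : ℤ_[p] => y - x) x
  filter_upwards [hlim.eventually (PadicInt.eventually_exists_natCast_mul hm.ne' U)]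
    with y ⟨u, hu, hy⟩
  have hχm : χ (m * u) = 0 := by
    rw [hmul u hu, ← Nat.cast_smul_eq_nsmul k, CharP.cast_eq_zero, zero_smul]
  rw [← add_sub_cancel x y, hy, hχ, hχm, map_zero, add_zero]
end
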